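/- Let J ⊆ ∘I be nonempty and let B be a real biconvex set in Δ_{J+}. Then there exist a unique subset K ⊆ J and a unique element u ∈ ∘W^K_J such that Δ^K_J(u, −) ⊆ B and B∖Δ^K_J(u, −) is finite. Moreover, B is an infinite set if and only if K ⊊ J. -/

import Mathlib

open scoped Pointwise

section

variable {ι V : Type*} [Fintype ι] [Nonempty ι] [AddCommGroup V] [Module ℝ V]

/-- The length of `w` with respect to a generating set `S` of a group. -/
noncomputable def lenG {G : Type*} [Group G] (S : Set G) (w : G) : ℕ :=
  sInf {n | ∃ l : List G, (∀ x ∈ l, x ∈ S) ∧ l.length = n ∧ l.prod = w}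

/-- `v` is a nonnegative linear combination of the simple roots `α` of `∘Δ`. -/
def PosoComb (α : ι → V) (v : V) : Prop :=
  ∃ c : ι → ℝ, (∀ i, 0 ≤ c i) ∧ v = ∑ i, c i • α i

/-- The parabolic subgroup `∘W_J = ⟨s_j | j ∈ J⟩` of the finite Weyl group, realized
inside the group of linear automorphisms of `𝔥* = V`. -/
def WoJ (α : ι → V) (s : V → V ≃ₗ[ℝ] V) (J : Set ι) : Subgroup (V ≃ₗ[ℝ] V) :=
  Subgroup.closure ((fun j => s (α j)) '' J)

/-- `∘Δ_J = ∘W_J(∘Π_J)` (so `∘Δ_∅ = ∅`). -/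
def DeloJ (α : ι → V) (s : V → V ≃ₗ[ℝ] V) (J : Set ι) : Set V :=
  {v | ∃ g ∈ WoJ α s J, ∃ j ∈ J, v = g (α j)}

/-- `∘Δ`, the root system of the underlying finite-dimensional simple Lie algebra. -/
def Delo (α : ι → V) (s : V → V ≃ₗ[ℝ] V) : Set V := DeloJ α s Set.univ

/-- `∘Δ^K_{J+} = (∘Δ_J ∖ ∘Δ_K) ∩ ∘Δ₊`. -/
def DeloKJpos (α : ι → V) (s : V → V ≃ₗ[ℝ] V) (J K : Set ι) : Set V :=
  (DeloJ α s J \ DeloJ α s K) ∩ {v | PosoComb α v}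

/-- `∘Δ^K_{J−} = (∘Δ_J ∖ ∘Δ_K) ∩ ∘Δ₋`. -/
def DeloKJneg (α : ι → V) (s : V → V ≃ₗ[ℝ] V) (J K : Set ι) : Set V :=
  (DeloJ α s J \ DeloJ α s K) ∩ {v | PosoComb α (-v)}

/-- The set `∘W^K_J` of minimal-length representatives of the right cosets `∘W_J/∘W_K`. -/
def MinReps (α : ι → V) (s : V → V ≃ₗ[ℝ] V) (J K : Set ι) : Set (V ≃ₗ[ℝ] V) :=
  {w | w ∈ WoJ α s J ∧ ∀ v ∈ WoJ α s K,
    lenG (Set.range fun i => s (α i)) w ≤ lenG (Set.range fun i => s (α i)) (w * v)}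

/-- The affine simple roots `Π = {α₀ = δ − θ} ∪ ∘Π`, indexed by `Option ι`. -/
def alHat (α : ι → V) (δ θ : V) : Option ι → V := fun o => o.elim (δ - θ) α

/-- `v` is a nonnegative linear combination of the affine simple roots. -/
def PosComb (α : ι → V) (δ θ : V) (v : V) : Prop :=
  ∃ c : Option ι → ℝ, (∀ o, 0 ≤ c o) ∧ v = ∑ o, c o • alHat α δ θ o

/-- The real roots `Δ^re = {mδ + ε | m ∈ ℤ, ε ∈ ∘Δ}`. -/
def DelRe (α : ι → V) (δ : V) (s : V → V ≃ₗ[ℝ] V) : Set V :=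
  {v | ∃ m : ℤ, ∃ ε ∈ Delo α s, v = m • δ + ε}

/-- The imaginary roots `Δ^im = {mδ | m ∈ ℤ ∖ {0}}`. -/
def DelIm (δ : V) : Set V := {v | ∃ m : ℤ, m ≠ 0 ∧ v = m • δ}

/-- The affine root system `Δ = Δ^re ∪ Δ^im`. -/
def Del (α : ι → V) (δ : V) (s : V → V ≃ₗ[ℝ] V) : Set V := DelRe α δ s ∪ DelIm δ

/-- The positive roots `Δ₊` (relative to `Π`). -/
def DelPos (α : ι → V) (δ θ : V) (s : V → V ≃ₗ[ℝ] V) : Set V :=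
  {v ∈ Del α δ s | PosComb α δ θ v}

/-- The negative roots `Δ₋ = −Δ₊`. -/
def DelNeg (α : ι → V) (δ θ : V) (s : V → V ≃ₗ[ℝ] V) : Set V :=
  {v | -v ∈ DelPos α δ θ s}

/-- `Δ^re₊ = Δ^re ∩ Δ₊`. -/
def DelRePos (α : ι → V) (δ θ : V) (s : V → V ≃ₗ[ℝ] V) : Set V :=
  DelRe α δ s ∩ DelPos α δ θ s

/-- `Δ^im₊ = {mδ | m ≥ 1}`. -/
def DelImPos (δ : V) : Set V := {v | ∃ m : ℕ, 0 < m ∧ v = (m : ℤ) • δ}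

/-- `⟨ε⟩ = {mδ + ε | m ∈ ℤ≥0} ∩ Δ^re₊`. -/
def brkt (α : ι → V) (δ θ : V) (s : V → V ≃ₗ[ℝ] V) (ε : V) : Set V :=
  {v | ∃ m : ℕ, v = (m : ℤ) • δ + ε} ∩ DelRePos α δ θ s

/-- `⟨P⟩ = ⋃_{ε ∈ P} ⟨ε⟩`. -/
def brSet (α : ι → V) (δ θ : V) (s : V → V ≃ₗ[ℝ] V) (P : Set V) : Set V :=
  ⋃ ε ∈ P, brkt α δ θ s ε

/-- `Δ^re_J = {mδ + ε | m ∈ ℤ, ε ∈ ∘Δ_J}`. -/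
def DelReJ (α : ι → V) (δ : V) (s : V → V ≃ₗ[ℝ] V) (J : Set ι) : Set V :=
  {v | ∃ m : ℤ, ∃ ε ∈ DeloJ α s J, v = m • δ + ε}

/-- `Δ_J = Δ^re_J ∪ Δ^im`. -/
def DelJ (α : ι → V) (δ : V) (s : V → V ≃ₗ[ℝ] V) (J : Set ι) : Set V :=
  DelReJ α δ s J ∪ DelIm δ

/-- `Δ_{J+} = Δ_J ∩ Δ₊`. -/
def DelJPos (α : ι → V) (δ θ : V) (s : V → V ≃ₗ[ℝ] V) (J : Set ι) : Set V :=
  DelJ α δ s J ∩ DelPos α δ θ s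

/-- `Δ_{J+} = ⟨∘Δ_J⟩ ∪ Δ^im₊` (the description used from Section 5 onwards). -/
def DelJPosB (α : ι → V) (δ θ : V) (s : V → V ≃ₗ[ℝ] V) (J : Set ι) : Set V :=
  brSet α δ θ s (DeloJ α s J) ∪ DelImPos δ

/-- The set of highest roots of the irreducible components of `∘Δ_J`, i.e. the maximal
elements of `∘Δ_{J+}`: the positive roots `ε` of `∘Δ_J` such that no `ε + α_j` is a root. -/
def HighRoots (α : ι → V) (s : V → V ≃ₗ[ℝ] V) (J : Set ι) : Set V :=
  {ε ∈ DeloJ α s J | PosoComb α ε ∧ ∀ j ∈ J, ε + α j ∉ DeloJ α s J}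

/-- `Π_J = ∘Π_J ⊔ {δ − θ_{J_c} | c}`. -/
def PiJ (α : ι → V) (δ : V) (s : V → V ≃ₗ[ℝ] V) (J : Set ι) : Set V :=
  (α '' J) ∪ (fun x => δ - x) '' HighRoots α s J

/-- `S_J = {s_α | α ∈ Π_J}`. -/
def SJ (α : ι → V) (δ : V) (s : V → V ≃ₗ[ℝ] V) (J : Set ι) : Set (V ≃ₗ[ℝ] V) :=
  s '' PiJ α δ s J

/-- `W_J = ⟨S_J⟩` (so `W_∅ = {1}`). -/
def WJ (α : ι → V) (δ : V) (s : V → V ≃ₗ[ℝ] V) (J : Set ι) : Subgroup (V ≃ₗ[ℝ] V) :=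
  Subgroup.closure (SJ α δ s J)

/-- `Φ_J(y) = {β ∈ Δ_{J+} | y⁻¹(β) < 0}`, with `Δ_{J+} = Δ_J ∩ Δ₊`. -/
def PhiJ (α : ι → V) (δ θ : V) (s : V → V ≃ₗ[ℝ] V) (J : Set ι) (y : V ≃ₗ[ℝ] V) : Set V :=
  {β ∈ DelJPos α δ θ s J | y⁻¹ β ∈ DelNeg α δ θ s}

/-- `Φ_J(y) = {β ∈ Δ_{J+} | y⁻¹(β) < 0}`, with `Δ_{J+} = ⟨∘Δ_J⟩ ∪ Δ^im₊`. -/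
def PhiJb (α : ι → V) (δ θ : V) (s : V → V ≃ₗ[ℝ] V) (J : Set ι) (y : V ≃ₗ[ℝ] V) : Set V :=
  {β ∈ DelJPosB α δ θ s J | y⁻¹ β ∈ DelNeg α δ θ s}

/-- `Δ^K_J(u, −) = ⟨u∘Δ^K_{J−}⟩`. -/
def DKJm (α : ι → V) (δ θ : V) (s : V → V ≃ₗ[ℝ] V) (J K : Set ι) (u : V ≃ₗ[ℝ] V) : Set V :=
  brSet α δ θ s (⇑u '' DeloKJneg α s J K)

/-- `Δ^K_J(u, +) = ⟨u∘Δ^K_{J+}⟩`. -/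
def DKJp (α : ι → V) (δ θ : V) (s : V → V ≃ₗ[ℝ] V) (J K : Set ι) (u : V ≃ₗ[ℝ] V) : Set V :=
  brSet α δ θ s (⇑u '' DeloKJpos α s J K)

/-- `B` is a convex set in `A`: `B ⊆ A` and `β, γ ∈ B`, `β + γ ∈ A` imply `β + γ ∈ B`. -/
def ConvexIn (A B : Set V) : Prop :=
  B ⊆ A ∧ ∀ x ∈ B, ∀ y ∈ B, x + y ∈ A → x + y ∈ B

/-- `B` is a biconvex set in `A`: both `B` and `A ∖ B` are convex sets in `A`. -/
def BiconvexIn (A B : Set V) : Prop :=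
  ConvexIn A B ∧ ConvexIn A (A \ B)

/-- `P ⊆ ∘Δ` is a closed set. -/
def ClosedIn (Δo P : Set V) : Prop :=
  ∀ ε ∈ P, ∀ η ∈ P, ε + η ∈ Δo → ε + η ∈ P

/-- The coroot `α_j^∨ = 2α_j/(α_j|α_j)`. -/
noncomputable def coroot (α : ι → V) (B : V →ₗ[ℝ] V →ₗ[ℝ] ℝ) (j : ι) : V :=
  (2 / B (α j) (α j)) • α j

/-- The coroot lattice `∘Q^∨_J = ⊕_{j ∈ J} ℤ α_j^∨`. -/
def QJ (α : ι → V) (B : V →ₗ[ℝ] V →ₗ[ℝ] ℝ) (J : Set ι) : Set V :=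
  {lam | ∃ c : ι → ℤ, (∀ j, j ∉ J → c j = 0) ∧ lam = ∑ j, c j • coroot α B j}

/-- `g` acts as the translation `t_λ`: `g(μ) = μ − (μ|λ)δ` for `μ` in the span of `Π`. -/
def IsTransl (α : ι → V) (δ θ : V) (B : V →ₗ[ℝ] V →ₗ[ℝ] ℝ) (lam : V)
    (g : V ≃ₗ[ℝ] V) : Prop :=
  ∀ μ ∈ Submodule.span ℝ (Set.range (alHat α δ θ)), g μ = μ - B μ lam • δ

/-- The translation subgroup `T_J = {t_λ | λ ∈ ∘Q^∨_J}` of `W_J`. -/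
def TJ (α : ι → V) (δ θ : V) (B : V →ₗ[ℝ] V →ₗ[ℝ] ℝ) (s : V → V ≃ₗ[ℝ] V)
    (J : Set ι) : Set (V ≃ₗ[ℝ] V) :=
  {g | g ∈ WJ α δ s J ∧ ∃ lam ∈ QJ α B J, IsTransl α δ θ B lam g}

/-- The hypotheses describing the root datum of an untwisted affine Kac–Moody Lie algebra
over `ℝ`: `α` are the simple roots of the underlying finite-dimensional simple Lie algebra,
`δ` is the null root, `θ` the highest root of `∘Δ`, `B` the standard invariant bilinear form,
and `s a` the reflection in a (real) root `a`. -/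
structure AffineSetup (α : ι → V) (δ θ : V) (B : V →ₗ[ℝ] V →ₗ[ℝ] ℝ)
    (s : V → V ≃ₗ[ℝ] V) : Prop where
  indep : LinearIndependent ℝ (alHat α δ θ)
  Bsymm : ∀ u v : V, B u v = B v u
  Bpos : ∀ v ∈ Delo α s, 0 < B v v
  refl_def : ∀ a : V, B a a ≠ 0 → ∀ v : V, s a v = v - (2 * B v a / B a a) • a
  delta_orth : ∀ i : ι, B δ (α i) = 0
  delta_null : B δ δ = 0
  theta_high : θ ∈ HighRoots α s Set.univ
  cryst : ∀ i : ι, ∀ v ∈ Delo α s, ∃ m : ℤ, s (α i) v = v - m • α i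
  base : ∀ v ∈ Delo α s, Xor' (PosoComb α v) (PosoComb α (-v))
  finite : (Delo α s).Finite
  reduced : ∀ v ∈ Delo α s, (2 : ℝ) • v ∉ Delo α s
  irred : ∀ A : Set ι, (∀ i ∈ A, ∀ j ∈ Aᶜ, s (α i) (α j) = α j) → A = ∅ ∨ A = Set.univ

namespace Aff

set_option linter.unusedSectionVars false

variable {α : ι → V} {δ θ : V} {Bl : V →ₗ[ℝ] V →ₗ[ℝ] ℝ} {s : V → V ≃ₗ[ℝ] V}

lemma WoJ_mono {J K : Set ι} (hK : K ⊆ J) : WoJ α s K ≤ WoJ α s J :=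
  Subgroup.closure_mono (Set.image_mono hK)

lemma DeloJ_mono {J K : Set ι} (hK : K ⊆ J) : DeloJ α s K ⊆ DeloJ α s J := by
  rintro v ⟨g, hg, j, hj, rfl⟩
  exact ⟨g, WoJ_mono hK hg, j, hK hj, rfl⟩

lemma DeloJ_sub (J : Set ι) : DeloJ α s J ⊆ Delo α s := DeloJ_mono (Set.subset_univ J)

lemma WoJ_sub (J : Set ι) : WoJ α s J ≤ WoJ α s Set.univ := WoJ_mono (Set.subset_univ J)

lemma simple_memJ {J : Set ι} {j : ι} (hj : j ∈ J) : α j ∈ DeloJ α s J :=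
  ⟨1, one_mem _, j, hj, rfl⟩

lemma simple_mem (j : ι) : α j ∈ Delo α s := simple_memJ (Set.mem_univ j)

lemma s_memW {J : Set ι} {j : ι} (hj : j ∈ J) : s (α j) ∈ WoJ α s J :=
  Subgroup.subset_closure ⟨j, hj, rfl⟩

lemma act_mem {J : Set ι} {g : V ≃ₗ[ℝ] V} (hg : g ∈ WoJ α s J) {v : V} (hv : v ∈ DeloJ α s J) :
    g v ∈ DeloJ α s J := by
  obtain ⟨k, hk, j, hj, rfl⟩ := hv
  exact ⟨g * k, mul_mem hg hk, j, hj, rfl⟩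

lemma act_mem_iff {J : Set ι} {g : V ≃ₗ[ℝ] V} (hg : g ∈ WoJ α s J) {v : V} :
    g v ∈ DeloJ α s J ↔ v ∈ DeloJ α s J := by
  refine ⟨fun hv => ?_, act_mem hg⟩
  have := act_mem (inv_mem hg) hv
  simpa using this

lemma root_ne {J : Set ι} (h : AffineSetup α δ θ Bl s) {v : V} (hv : v ∈ DeloJ α s J) : v ≠ 0 := by
  rintro rfl
  have := h.Bpos 0 (DeloJ_sub J hv)
  simp at this

lemma refl_root (h : AffineSetup α δ θ Bl s) {a : V} (ha : a ∈ Delo α s) (v : V) :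
    s a v = v - (2 * Bl v a / Bl a a) • a := h.refl_def a (h.Bpos a ha).ne' v

lemma s_isom (h : AffineSetup α δ θ Bl s) {a : V} (ha : a ∈ Delo α s) (x y : V) :
    Bl (s a x) (s a y) = Bl x y := by
  have hp := h.Bpos a ha
  rw [refl_root h ha, refl_root h ha]
  simp only [map_sub, map_smul, LinearMap.sub_apply, LinearMap.smul_apply, smul_eq_mul]
  rw [h.Bsymm a y]
  field_simp
  ring

lemma isom (h : AffineSetup α δ θ Bl s) {g : V ≃ₗ[ℝ] V} (hg : g ∈ WoJ α s Set.univ) :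
    ∀ x y : V, Bl (g x) (g y) = Bl x y := by
  refine Subgroup.closure_induction (p := fun g _ => ∀ x y : V, Bl (g x) (g y) = Bl x y)
    ?_ ?_ ?_ ?_ hg
  · rintro _ ⟨j, _, rfl⟩ x y
    exact s_isom h (simple_mem j) x y
  · intro x y; rfl
  · intro a b _ _ ha hb x y
    rw [LinearEquiv.mul_apply, LinearEquiv.mul_apply, ha, hb]
  · intro a _ ha x y
    rw [← ha]; simp

lemma conj (h : AffineSetup α δ θ Bl s) {g : V ≃ₗ[ℝ] V} (hg : g ∈ WoJ α s Set.univ) {a : V}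
    (ha : a ∈ Delo α s) : s (g a) = g * s a * g⁻¹ := by
  ext v
  have hga : g a ∈ Delo α s := act_mem hg ha
  have e : Bl v (g a) = Bl (g⁻¹ v) a := by
    rw [← isom h hg (g⁻¹ v) a]; simp
  rw [refl_root h hga, LinearEquiv.mul_apply, LinearEquiv.mul_apply, refl_root h ha, map_sub,
    map_smul, isom h hg, e]
  simp

lemma s_self (h : AffineSetup α δ θ Bl s) {a : V} (ha : a ∈ Delo α s) : s a a = -a := by
  have hp := (h.Bpos a ha).ne'
  rw [refl_root h ha, mul_div_assoc, div_self hp, mul_one, two_smul]; abel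

lemma s_s (h : AffineSetup α δ θ Bl s) {a : V} (ha : a ∈ Delo α s) (v : V) : s a (s a v) = v := by
  have hp := (h.Bpos a ha).ne'
  conv_lhs => rw [refl_root h ha v, map_sub, map_smul, s_self h ha, refl_root h ha v]
  simp

lemma s_sq (h : AffineSetup α δ θ Bl s) {a : V} (ha : a ∈ Delo α s) : s a * s a = 1 := by
  ext v; exact s_s h ha v

lemma s_inv (h : AffineSetup α δ θ Bl s) {a : V} (ha : a ∈ Delo α s) : (s a)⁻¹ = s a :=
  inv_eq_of_mul_eq_one_left (s_sq h ha)

lemma s_mem (h : AffineSetup α δ θ Bl s) {J : Set ι} {a : V} (ha : a ∈ DeloJ α s J) :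
    s a ∈ WoJ α s J := by
  obtain ⟨g, hg, j, hj, rfl⟩ := ha
  rw [conj h (WoJ_sub J hg) (simple_mem j)]
  exact mul_mem (mul_mem hg (s_memW hj)) (inv_mem hg)

lemma neg_mem' (h : AffineSetup α δ θ Bl s) {J : Set ι} {a : V} (ha : a ∈ DeloJ α s J) :
    -a ∈ DeloJ α s J := by
  rw [← s_self h (DeloJ_sub J ha)]
  exact act_mem (s_mem h ha) ha

lemma neg_mem_iff' (h : AffineSetup α δ θ Bl s) {J : Set ι} {a : V} :
    -a ∈ DeloJ α s J ↔ a ∈ DeloJ α s J :=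
  ⟨fun ha => by simpa using neg_mem' h ha, neg_mem' h⟩

lemma integ (h : AffineSetup α δ θ Bl s) {a b : V} (ha : a ∈ Delo α s) (hb : b ∈ Delo α s) :
    ∃ m : ℤ, 2 * Bl a b = m * Bl b b := by
  obtain ⟨g, hg, j, hj, rfl⟩ := hb
  have hv : g⁻¹ a ∈ Delo α s := act_mem (inv_mem hg) ha
  obtain ⟨m, hm⟩ := h.cryst j _ hv
  refine ⟨m, ?_⟩
  have e : Bl a (g (α j)) = Bl (g⁻¹ a) (α j) := by
    rw [← isom h hg (g⁻¹ a) (α j)]; simp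
  rw [isom h hg, e]
  rw [refl_root h (simple_mem j)] at hm
  have h1 : (2 * Bl (g⁻¹ a) (α j) / Bl (α j) (α j) - (m : ℝ)) • α j = 0 := by
    rw [sub_smul, Int.cast_smul_eq_zsmul, sub_eq_zero]
    exact sub_right_injective hm
  rcases smul_eq_zero.mp h1 with h2 | h2
  · have hp := h.Bpos _ (simple_mem (s := s) (α := α) j)
    have := sub_eq_zero.mp h2
    rwa [div_eq_iff hp.ne'] at this
  · exact absurd h2 (root_ne h (simple_mem j))

lemma s_of_int (h : AffineSetup α δ θ Bl s) {a b : V} (hb : b ∈ Delo α s) {m : ℝ}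
    (hm : 2 * Bl a b = m * Bl b b) : s b a = a - m • b := by
  rw [refl_root h hb, hm, mul_div_assoc, div_self (h.Bpos b hb).ne', mul_one]

/-- The canonical invariant form. -/
noncomputable def FF (h : AffineSetup α δ θ Bl s) (x y : V) : ℝ :=
  ∑ c ∈ h.finite.toFinset, Bl x c * Bl y c

lemma FF_inv (h : AffineSetup α δ θ Bl s) {b : V} (hb : b ∈ Delo α s) (x y : V) :
    FF h (s b x) (s b y) = FF h x y := by
  unfold FF
  have hm : ∀ c ∈ Delo α s, s b c ∈ Delo α s := fun c hc => act_mem (s_mem h hb) hc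
  refine Finset.sum_nbij' (fun c => s b c) (fun c => s b c) ?_ ?_ ?_ ?_ ?_
  · intro c hc; simpa using hm c (by simpa using hc)
  · intro c hc; simpa using hm c (by simpa using hc)
  · intro c _; exact s_s h hb c
  · intro c _; exact s_s h hb c
  · intro c _
    have e : ∀ z, Bl (s b z) c = Bl z (s b c) := fun z => by
      rw [← s_isom h hb z (s b c), s_s h hb]
    rw [e, e]

lemma FF_pos (h : AffineSetup α δ θ Bl s) {a : V} (ha : a ∈ Delo α s) : 0 < FF h a a := by
  unfold FF
  refine Finset.sum_pos' (fun c _ => mul_self_nonneg _) ⟨a, by simpa using ha, ?_⟩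
  have := h.Bpos a ha
  positivity

lemma FF_symm (h : AffineSetup α δ θ Bl s) (x y : V) : FF h x y = FF h y x := by
  unfold FF; simp_rw [mul_comm]

lemma FF_int (h : AffineSetup α δ θ Bl s) {a b : V} (hb : b ∈ Delo α s) {m : ℝ}
    (hm : 2 * Bl a b = m * Bl b b) : 2 * FF h a b = m * FF h b b := by
  have e := FF_inv h hb a b
  rw [s_of_int h hb hm, s_self h hb] at e
  have : FF h (a - m • b) (-b) = - FF h a b + m * FF h b b := by
    unfold FF
    rw [Finset.mul_sum, ← Finset.sum_neg_distrib, ← Finset.sum_add_distrib]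
    refine Finset.sum_congr rfl fun c _ => ?_
    simp only [map_sub, map_smul, map_neg, LinearMap.sub_apply, LinearMap.smul_apply,
      LinearMap.neg_apply, smul_eq_mul]
    ring
  linarith

lemma FF_cs (h : AffineSetup α δ θ Bl s) (a b : V) : FF h a b ^ 2 ≤ FF h a a * FF h b b := by
  unfold FF
  have := Finset.sum_mul_sq_le_sq_mul_sq h.finite.toFinset (fun c => Bl a c) (fun c => Bl b c)
  simpa [pow_two] using this

lemma sub_root (h : AffineSetup α δ θ Bl s) {J : Set ι} {a b : V} (ha : a ∈ DeloJ α s J)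
    (hb : b ∈ DeloJ α s J) (hab : 0 < Bl a b) (hne : a ≠ b) : a - b ∈ DeloJ α s J := by
  have ha' := DeloJ_sub J ha
  have hb' := DeloJ_sub J hb
  obtain ⟨p, hp⟩ := integ h ha' hb'
  obtain ⟨q, hq⟩ := integ h hb' ha'
  have hA := h.Bpos a ha'
  have hB := h.Bpos b hb'
  have hba : 0 < Bl b a := by rw [h.Bsymm]; exact hab
  have p1 : 0 < p := by
    have : (0:ℝ) < p := by
      by_contra hc
      push Not at hc
      nlinarith
    exact_mod_cast this
  have q1 : 0 < q := by
    have : (0:ℝ) < q := by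
      by_contra hc
      push Not at hc
      nlinarith
    exact_mod_cast this
  have hpq : p * q ≤ 4 := by
    have f1 := FF_int h hb' hp
    have f2 := FF_int h ha' hq
    rw [FF_symm h b a] at f2
    have f3 := FF_cs h a b
    have f4 := FF_pos h ha'
    have f5 := FF_pos h hb'
    have f6 : ((p:ℝ) * q) * (FF h a a * FF h b b) ≤ 4 * (FF h a a * FF h b b) := by
      have : ((p:ℝ) * q) * (FF h a a * FF h b b) = (2 * FF h a b) * (2 * FF h a b) := by
        conv_rhs => rw [f1]
        rw [← f1, f2] 
        nth_rewrite 1 [← f2]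
        rw [f1]; ring
      nlinarith
    have := le_of_mul_le_mul_right f6 (by positivity)
    exact_mod_cast this
  by_cases hp1 : p = 1
  · have := s_of_int h hb' hp
    rw [hp1] at this
    simp only [Int.cast_one, one_smul] at this
    rw [← this]
    exact act_mem (s_mem h hb) ha
  by_cases hq1 : q = 1
  · have := s_of_int h ha' hq
    rw [hq1] at this
    simp only [Int.cast_one, one_smul] at this
    rw [← neg_sub, ← this]
    exact neg_mem' h (act_mem (s_mem h ha) hb)
  exfalso
  have hp2 : p = 2 := by nlinarith [show 2 ≤ p by omega, show 2 ≤ q by omega]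
  have hq2 : q = 2 := by nlinarith [show 2 ≤ p by omega, show 2 ≤ q by omega]
  subst hp2 hq2
  have e1 := s_of_int h hb' hp
  have e2 := s_of_int h ha' hq
  have e3 := s_self h ha'
  have e4 := s_self h hb'
  have key : ∀ n : ℕ, a + (n : ℝ) • ((2:ℝ) • (a - b)) ∈ Delo α s := by
    intro n
    induction n with
    | zero => simpa using ha'
    | succ n ih =>
      have := act_mem (s_mem h ha') (act_mem (s_mem h hb') ih)
      have e : s a (s b (a + (n : ℝ) • ((2:ℝ) • (a - b))))
          = a + ((n + 1 : ℕ) : ℝ) • ((2:ℝ) • (a - b)) := by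
        simp only [map_add, map_smul, map_sub, e1, e2, e3, e4, map_neg]
        push_cast
        module
      rw [e] at this
      exact this
  refine (Set.infinite_of_injective_forall_mem ?_ key) h.finite
  intro m n hmn
  have h1 : ((m:ℝ) - n) • ((2:ℝ) • (a - b)) = 0 := by
    rw [sub_smul, sub_eq_zero]; exact add_left_cancel hmn
  rcases smul_eq_zero.mp h1 with h2 | h2
  · exact_mod_cast sub_eq_zero.mp h2
  · rcases smul_eq_zero.mp h2 with h3 | h3
    · norm_num at h3
    · exact absurd (sub_eq_zero.mp h3) hne

lemma add_root (h : AffineSetup α δ θ Bl s) {J : Set ι} {a b : V} (ha : a ∈ DeloJ α s J)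
    (hb : b ∈ DeloJ α s J) (hab : Bl a b < 0) (hne : a ≠ -b) : a + b ∈ DeloJ α s J := by
  have := sub_root h ha (neg_mem' h hb) (by simpa using hab) hne
  simpa using this

lemma exists_coord (h : AffineSetup α δ θ Bl s) : ∃ (f : V →ₗ[ℝ] (ι → ℝ)) (d : V →ₗ[ℝ] ℝ),
    (∀ c : ι → ℝ, f (∑ i, c i • α i) = c) ∧ f δ = 0 ∧ d δ = 1 ∧ ∀ i, d (α i) = 0 := by
  classical
  have hinj : LinearMap.ker (Fintype.linearCombination ℝ (alHat α δ θ)) = ⊥ := by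
    have := h.indep.fintypeLinearCombination_injective
    exact LinearMap.ker_eq_bot.mpr this
  obtain ⟨F, hF⟩ := LinearMap.exists_leftInverse_of_injective _ hinj
  have hF' : ∀ o, F (alHat α δ θ o) = Pi.single o 1 := by
    intro o
    have := LinearMap.congr_fun hF (Pi.single o 1)
    simpa [Fintype.linearCombination_apply_single] using this
  have hα : ∀ i, F (α i) = Pi.single (some i) 1 := fun i => hF' (some i)
  have h0 : F (δ - θ) = Pi.single none 1 := hF' none
  have hθ : F θ none = 0 := by
    obtain ⟨c, _, hc⟩ := h.theta_high.2.1
    rw [hc]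
    simp [hα]
  have hδ : F δ = Pi.single none 1 + F θ := by
    rw [← h0, map_sub]; abel
  let d : V →ₗ[ℝ] ℝ := (LinearMap.proj none).comp F
  have hd : ∀ v, d v = F v none := fun v => rfl
  refine ⟨LinearMap.pi fun i => (LinearMap.proj (some i)).comp F - (F θ (some i)) • d, d, ?_, ?_, ?_, ?_⟩
  · intro c
    ext i
    simp [hd, hα, Pi.single_apply]
  · ext i
    simp [hd, hδ, hθ]
  · simp [hd, hδ, hθ]
  · intro i; simp [hd, hα]

/-- Coordinates along the simple roots. -/
noncomputable def co (h : AffineSetup α δ θ Bl s) : V →ₗ[ℝ] (ι → ℝ) := (exists_coord h).choose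

lemma co_sum (h : AffineSetup α δ θ Bl s) (c : ι → ℝ) : co h (∑ i, c i • α i) = c :=
  (exists_coord h).choose_spec.choose_spec.1 c

/-- Coordinate along the null root. -/
noncomputable def dc (h : AffineSetup α δ θ Bl s) : V →ₗ[ℝ] ℝ := (exists_coord h).choose_spec.choose

lemma dc_delta (h : AffineSetup α δ θ Bl s) : dc h δ = 1 :=
  (exists_coord h).choose_spec.choose_spec.2.2.1

lemma dc_simple (h : AffineSetup α δ θ Bl s) (i : ι) : dc h (α i) = 0 :=
  (exists_coord h).choose_spec.choose_spec.2.2.2 i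

lemma co_self (h : AffineSetup α δ θ Bl s) (i : ι) : co h (α i) i = 1 := by
  classical
  have := co_sum h (Pi.single i 1)
  simp only [Pi.single_apply, ite_smul, one_smul, zero_smul, Finset.sum_ite_eq', Finset.mem_univ,
    if_true] at this
  rw [this]; simp

lemma co_ne (h : AffineSetup α δ θ Bl s) {i j : ι} (hij : j ≠ i) : co h (α i) j = 0 := by
  classical
  have := co_sum h (Pi.single i 1)
  simp only [Pi.single_apply, ite_smul, one_smul, zero_smul, Finset.sum_ite_eq', Finset.mem_univ,
    if_true] at this
  rw [this]; simp [hij]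

lemma pos_coef (h : AffineSetup α δ θ Bl s) {v : V} (hv : PosoComb α v) (i : ι) : 0 ≤ co h v i := by
  obtain ⟨c, hc, rfl⟩ := hv
  rw [co_sum]; exact hc i

lemma pos_eq (h : AffineSetup α δ θ Bl s) {v : V} (hv : PosoComb α v) :
    v = ∑ i, co h v i • α i := by
  obtain ⟨c, hc, rfl⟩ := hv
  rw [co_sum]

lemma pos_or (h : AffineSetup α δ θ Bl s) {J : Set ι} {v : V} (hv : v ∈ DeloJ α s J) :
    PosoComb α v ∨ PosoComb α (-v) := by
  rcases h.base v (DeloJ_sub J hv) with h1 | h1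
  · exact Or.inl h1.1
  · exact Or.inr h1.1

lemma not_both (h : AffineSetup α δ θ Bl s) {J : Set ι} {v : V} (hv : v ∈ DeloJ α s J)
    (h1 : PosoComb α v) (h2 : PosoComb α (-v)) : False := by
  rcases h.base v (DeloJ_sub J hv) with h3 | h3
  · exact h3.2 h2
  · exact h3.2 h1

lemma root_eq (h : AffineSetup α δ θ Bl s) {J : Set ι} {v : V} (hv : v ∈ DeloJ α s J) :
    v = ∑ i, co h v i • α i := by
  rcases pos_or h hv with h1 | h1
  · exact pos_eq h h1
  · have := pos_eq h h1
    simp only [map_neg, Pi.neg_apply, neg_smul, Finset.sum_neg_distrib, neg_inj] at this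
    exact this

lemma dc_root (h : AffineSetup α δ θ Bl s) {J : Set ι} {v : V} (hv : v ∈ DeloJ α s J) :
    dc h v = 0 := by
  rw [root_eq h hv]; simp [dc_simple]

lemma simple_pos (h : AffineSetup α δ θ Bl s) (j : ι) : PosoComb α (α j) := by
  rcases pos_or h (simple_mem (s := s) (α := α) j) with h1 | h1
  · exact h1
  · have := pos_coef h h1 j
    rw [map_neg, Pi.neg_apply, co_self] at this
    norm_num at this

lemma co_act (h : AffineSetup α δ θ Bl s) {J : Set ι} {g : V ≃ₗ[ℝ] V} (hg : g ∈ WoJ α s J) :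
    ∀ x, ∀ i ∉ J, co h (g x) i = co h x i := by
  refine Subgroup.closure_induction (p := fun g _ => ∀ x, ∀ i ∉ J, co h (g x) i = co h x i)
    ?_ ?_ ?_ ?_ hg
  · rintro _ ⟨j, hj, rfl⟩ x i hi
    have hne : i ≠ j := by rintro rfl; exact hi hj
    simp only []
    rw [refl_root h (simple_mem j)]
    simp [co_ne h hne]
  · intro x i _; rfl
  · intro a b _ _ ha hb x i hi
    rw [LinearEquiv.mul_apply, ha _ i hi, hb _ i hi]
  · intro a _ ha x i hi
    rw [← ha _ i hi]; simp

lemma co_supp (h : AffineSetup α δ θ Bl s) {J : Set ι} {v : V} (hv : v ∈ DeloJ α s J) :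
    ∀ i ∉ J, co h v i = 0 := by
  obtain ⟨g, hg, j, hj, rfl⟩ := hv
  intro i hi
  rw [co_act h hg _ i hi]
  exact co_ne h (by rintro rfl; exact hi hj)

lemma mult_simple (h : AffineSetup α δ θ Bl s) {v : V} (hv : v ∈ Delo α s) {j : ι} {c : ℝ}
    (hc : 0 ≤ c) (hvc : v = c • α j) : v = α j := by
  have hj := simple_mem (s := s) (α := α) j
  have hA := h.Bpos _ hj
  obtain ⟨p, hp⟩ := integ h hv hj
  obtain ⟨q, hq⟩ := integ h hj hv
  have hc0 : c ≠ 0 := by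
    rintro rfl
    exact root_ne h hv (by simpa using hvc)
  have hcp : 0 < c := lt_of_le_of_ne hc hc0.symm
  rw [hvc] at hp hq
  simp only [map_smul, LinearMap.smul_apply, smul_eq_mul] at hp hq
  have hp' : 2 * c = p := by
    have : (2 * c - p) * Bl (α j) (α j) = 0 := by linarith
    rcases mul_eq_zero.mp this with h1 | h1
    · linarith
    · exact absurd h1 hA.ne'
  have hq' : 2 = q * c := by
    have : (2 - q * c) * (c * Bl (α j) (α j)) = 0 := by linarith
    rcases mul_eq_zero.mp this with h1 | h1
    · linarith
    · exact absurd h1 (by positivity)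
  have hpq : p * q = 4 := by
    have : (p : ℝ) * q = 4 := by rw [← hp']; linarith
    exact_mod_cast this
  have hp0 : 0 < p := by
    have : (0:ℝ) < p := by rw [← hp']; positivity
    exact_mod_cast this
  have hp4 : p ≤ 4 := Int.le_of_dvd (by norm_num) ⟨q, hpq.symm⟩
  have cases4 : p = 1 ∨ p = 2 ∨ p = 4 := by
    interval_cases p <;> omega
  rcases cases4 with rfl | rfl | rfl
  · exfalso
    refine h.reduced v hv ?_
    rw [hvc, smul_smul, hp']
    simpa using hj
  · have : c = 1 := by push_cast at hp'; linarith
    rw [hvc, this, one_smul]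
  · exfalso
    have : c = 2 := by push_cast at hp'; linarith
    exact h.reduced _ hj (by rw [← this, ← hvc]; exact hv)

/-- a positive root that becomes negative after a modification of its `j`-th coordinate is `α j` -/
lemma eq_simple (h : AffineSetup α δ θ Bl s) {J : Set ι} {v : V} (hv : v ∈ DeloJ α s J)
    (hpos : PosoComb α v) {j : ι} (hle : ∀ i, i ≠ j → co h v i ≤ 0) : v = α j := by
  refine mult_simple h (DeloJ_sub J hv) (pos_coef h hpos j) ?_
  conv_lhs => rw [pos_eq h hpos]
  refine Finset.sum_eq_single j ?_ (by simp)
  intro i _ hi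
  rw [le_antisymm (hle i hi) (pos_coef h hpos i), zero_smul]

lemma co_s_ne (h : AffineSetup α δ θ Bl s) (v : V) {i j : ι} (hij : i ≠ j) :
    co h (s (α j) v) i = co h v i := by
  rw [refl_root h (simple_mem j)]
  simp [co_ne h hij]

lemma s_pos (h : AffineSetup α δ θ Bl s) {J : Set ι} {v : V} (hv : v ∈ DeloJ α s J)
    (hpos : PosoComb α v) {j : ι} (hne : v ≠ α j) : PosoComb α (s (α j) v) := by
  have hv' : s (α j) v ∈ Delo α s := act_mem (s_memW (Set.mem_univ j)) (DeloJ_sub J hv)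
  rcases pos_or h hv' with h1 | h1
  · exact h1
  · exfalso
    refine hne (eq_simple h hv hpos fun i hi => ?_)
    have := pos_coef h h1 i
    rw [map_neg, Pi.neg_apply, co_s_ne h v hi] at this
    linarith

/-- height -/
noncomputable def ht (h : AffineSetup α δ θ Bl s) (v : V) : ℝ := ∑ i, co h v i

lemma ht_sub (h : AffineSetup α δ θ Bl s) (v : V) (c : ℝ) (j : ι) :
    ht h (v - c • α j) = ht h v - c := by
  have : ht h (α j) = 1 := by
    unfold ht
    rw [Finset.sum_eq_single j, co_self]
    · intro i _ hi; exact co_ne h hi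
    · simp
  unfold ht at *
  simp only [map_sub, map_smul, Pi.sub_apply, Pi.smul_apply, smul_eq_mul, Finset.sum_sub_distrib,
    ← Finset.mul_sum, this]
  ring

lemma fin_ind {S : Set V} (hS : S.Finite) (f : V → ℝ) {P : V → Prop}
    (hP : ∀ x ∈ S, (∀ y ∈ S, f y < f x → P y) → P x) : ∀ x ∈ S, P x := by
  by_contra hc
  push Not at hc
  obtain ⟨x, hx, hxP⟩ := hc
  obtain ⟨y, hy, hmin⟩ := Set.exists_min_image {x ∈ S | ¬ P x} f (hS.subset (Set.sep_subset _ _))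
    ⟨x, hx, hxP⟩
  refine hy.2 (hP y hy.1 fun z hz hlt => ?_)
  by_contra hzP
  exact absurd (hmin z ⟨hz, hzP⟩) (not_le.mpr hlt)

lemma exists_pos (h : AffineSetup α δ θ Bl s) {J : Set ι} {v : V} (hv : v ∈ DeloJ α s J)
    (hpos : PosoComb α v) : ∃ j, 0 < co h v j ∧ 0 < Bl v (α j) := by
  by_contra hc
  push Not at hc
  have h1 := h.Bpos v (DeloJ_sub J hv)
  have h2 : Bl v v = ∑ i, co h v i * Bl v (α i) := by
    conv_lhs => rw [pos_eq h hpos]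
    rw [← pos_eq h hpos]
    conv_lhs => rw [pos_eq h hpos, ← pos_eq h hpos]
    nth_rewrite 2 [pos_eq h hpos]
    simp only [map_sum, map_smul, smul_eq_mul]
  have h3 : ∑ i, co h v i * Bl v (α i) ≤ 0 := by
    refine Finset.sum_nonpos fun i _ => ?_
    have h4 := pos_coef h hpos i
    rcases h4.eq_or_lt with h5 | h5
    · rw [← h5]; simp
    · exact mul_nonpos_of_nonneg_of_nonpos h4 (hc i h5)
  linarith

lemma decomp (h : AffineSetup α δ θ Bl s) {J : Set ι} {v : V} (hv : v ∈ DeloJ α s J)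
    (hpos : PosoComb α v) : ∃ j ∈ J, v = α j ∨ (v - α j ∈ DeloJ α s J ∧ PosoComb α (v - α j)) := by
  obtain ⟨j, h1, h2⟩ := exists_pos h hv hpos
  have hj : j ∈ J := by
    by_contra hj
    rw [co_supp h hv j hj] at h1
    exact lt_irrefl _ h1
  refine ⟨j, hj, ?_⟩
  by_cases hne : v = α j
  · exact Or.inl hne
  have hm := sub_root h hv (simple_memJ hj) h2 hne
  refine Or.inr ⟨hm, ?_⟩
  rcases pos_or h hm with h3 | h3
  · exact h3
  · exfalso
    refine hne (eq_simple h hv hpos fun i hi => ?_)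
    have := pos_coef h h3 i
    simp only [map_neg, map_sub, Pi.neg_apply, Pi.sub_apply, co_ne h hi] at this
    linarith

lemma DeloJ_finite (h : AffineSetup α δ θ Bl s) (J : Set ι) : (DeloJ α s J).Finite :=
  h.finite.subset (DeloJ_sub J)

lemma pos_ind (h : AffineSetup α δ θ Bl s) {J : Set ι} {P : V → Prop} (h1 : ∀ j ∈ J, P (α j))
    (h2 : ∀ β, ∀ j ∈ J, β ∈ DeloJ α s J → PosoComb α β → β + α j ∈ DeloJ α s J → P β →
      P (β + α j)) : ∀ β ∈ DeloJ α s J, PosoComb α β → P β := by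
  refine fin_ind (DeloJ_finite h J) (ht h) ?_
  intro v hv ih hpos
  obtain ⟨j, hj, h3 | ⟨h3, h4⟩⟩ := decomp h hv hpos
  · rw [h3]; exact h1 j hj
  · have h5 : P (v - α j) := by
      refine ih _ h3 ?_ h4
      have := ht_sub h v 1 j
      rw [one_smul] at this
      rw [this]; linarith
    have := h2 (v - α j) j hj h3 h4 (by simpa using hv) h5
    simpa using this

lemma supp_mem (h : AffineSetup α δ θ Bl s) {K : Set ι} : ∀ v ∈ Delo α s, PosoComb α v →
    (∀ i ∉ K, co h v i = 0) → v ∈ DeloJ α s K := by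
  refine fin_ind h.finite (ht h) ?_
  intro v hv ih hpos hsupp
  obtain ⟨j, h1, h2⟩ := exists_pos h hv hpos
  have hj : j ∈ K := by
    by_contra hj
    rw [hsupp j hj] at h1
    exact lt_irrefl _ h1
  by_cases hne : v = α j
  · rw [hne]; exact simple_memJ hj
  have h3 : s (α j) v ∈ Delo α s := act_mem (s_memW (Set.mem_univ j)) hv
  rw [← act_mem_iff (s_memW hj)]
  refine ih _ h3 ?_ (s_pos h hv hpos hne) ?_
  · rw [refl_root h (simple_mem j), ht_sub]
    have := h.Bpos _ (simple_mem (s := s) (α := α) j)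
    have : 0 < 2 * Bl v (α j) / Bl (α j) (α j) := by positivity
    linarith
  · intro i hi
    rw [co_s_ne h v (by rintro rfl; exact hi hj)]
    exact hsupp i hi

lemma simple_mem_iff (h : AffineSetup α δ θ Bl s) {K : Set ι} {j : ι} :
    α j ∈ DeloJ α s K ↔ j ∈ K := by
  refine ⟨fun hj => ?_, simple_memJ⟩
  by_contra hc
  have := co_supp h hj j hc
  rw [co_self] at this
  norm_num at this

/-- product of simple reflections along a word -/
def wd (α : ι → V) (s : V → V ≃ₗ[ℝ] V) (l : List ι) : V ≃ₗ[ℝ] V := (l.map fun i => s (α i)).prod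

lemma wd_nil : wd α s [] = 1 := rfl

lemma wd_cons (i : ι) (l : List ι) : wd α s (i :: l) = s (α i) * wd α s l := by
  simp [wd]

lemma wd_append (l l' : List ι) : wd α s (l ++ l') = wd α s l * wd α s l' := by
  simp [wd]

lemma wd_mem {J : Set ι} {l : List ι} (hl : ∀ i ∈ l, i ∈ J) : wd α s l ∈ WoJ α s J := by
  refine Subgroup.list_prod_mem _ ?_
  intro x hx
  obtain ⟨i, hi, rfl⟩ := List.mem_map.mp hx
  exact s_memW (hl i hi)

lemma exists_wd (h : AffineSetup α δ θ Bl s) {J : Set ι} {g : V ≃ₗ[ℝ] V} (hg : g ∈ WoJ α s J) :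
    ∃ l : List ι, (∀ i ∈ l, i ∈ J) ∧ wd α s l = g := by
  refine Subgroup.closure_induction
    (p := fun g _ => ∃ l : List ι, (∀ i ∈ l, i ∈ J) ∧ wd α s l = g) ?_ ?_ ?_ ?_ hg
  · rintro _ ⟨j, hj, rfl⟩
    exact ⟨[j], by simpa using hj, by simp [wd]⟩
  · exact ⟨[], by simp, rfl⟩
  · rintro _ _ _ _ ⟨l, hl, rfl⟩ ⟨l', hl', rfl⟩
    refine ⟨l ++ l', ?_, wd_append l l'⟩
    intro i hi
    rcases List.mem_append.mp hi with hi | hi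
    · exact hl i hi
    · exact hl' i hi
  · rintro _ hx ⟨l, hl, rfl⟩
    refine ⟨l.reverse, by simpa using hl, ?_⟩
    clear hl hx
    induction l with
    | nil => simp [wd]
    | cons i l ih =>
      rw [List.reverse_cons, wd_append, ih, wd_cons i l, mul_inv_rev, s_inv h (simple_mem i)]
      simp [wd]

lemma exchange (h : AffineSetup α δ θ Bl s) (k : ι) (l : List ι)
    (hn : PosoComb α (-(wd α s l (α k)))) :
    ∃ l' : List ι, l'.Sublist l ∧ l'.length + 1 = l.length ∧ wd α s l * s (α k) = wd α s l' := by
  induction l with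
  | nil =>
    exfalso
    exact not_both h (simple_mem (s := s) k) (simple_pos h k) (by simpa [wd] using hn)
  | cons i l ih =>
    have hW : wd α s l ∈ WoJ α s Set.univ := wd_mem (by simp)
    have hr : wd α s l (α k) ∈ Delo α s := act_mem hW (simple_mem k)
    by_cases hl : PosoComb α (-(wd α s l (α k)))
    · obtain ⟨l', h1, h2, h3⟩ := ih hl
      refine ⟨i :: l', h1.cons_cons i, by simp [h2], ?_⟩
      rw [wd_cons, wd_cons, mul_assoc, h3]
    · have hp := (pos_or h hr).resolve_right hl
      have he : wd α s l (α k) = α i := by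
        by_contra hne
        have h1 := s_pos h hr hp hne
        rw [wd_cons, LinearEquiv.mul_apply] at hn
        exact not_both h (act_mem (s_memW (Set.mem_univ i)) hr) h1 hn
      refine ⟨l, List.sublist_cons_self i l, by simp, ?_⟩
      have hc := conj h hW (simple_mem (s := s) (α := α) k)
      rw [he] at hc
      rw [wd_cons, hc]
      have := s_sq h (simple_mem (s := s) (α := α) k)
      simp [mul_assoc, this]

lemma eq_one (h : AffineSetup α δ θ Bl s) {J : Set ι} {w : V ≃ₗ[ℝ] V} (hw : w ∈ WoJ α s J)
    (hp : ∀ j ∈ J, PosoComb α (w (α j))) : w = 1 := by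
  have hex : ∃ n, ∃ l : List ι, l.length = n ∧ (∀ i ∈ l, i ∈ J) ∧ wd α s l = w := by
    obtain ⟨l, h1, h2⟩ := exists_wd h hw
    exact ⟨_, l, rfl, h1, h2⟩
  classical
  obtain ⟨l, hlen, hl, hlw⟩ := Nat.find_spec hex
  rcases List.eq_nil_or_concat l with rfl | ⟨l', j, rfl⟩
  · rw [← hlw]; rfl
  exfalso
  rw [List.concat_eq_append] at *
  have hj : j ∈ J := hl j (by simp)
  have hsj : wd α s [j] = s (α j) := by simp [wd]
  have h1 := hp j hj
  rw [← hlw, wd_append, hsj, LinearEquiv.mul_apply, s_self h (simple_mem j), map_neg] at h1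
  obtain ⟨l'', h2, h3, h4⟩ := exchange h j l' h1
  have h5 := Nat.find_min' hex ⟨l'', rfl, fun i hi => hl i (by simp [h2.subset hi]), by
    rw [← h4, ← hlw, wd_append, hsj]⟩
  rw [← hlen] at h5
  simp at h5
  omega

lemma lenG_le (l : List ι) : lenG (Set.range fun i => s (α i)) (wd α s l) ≤ l.length := by
  refine Nat.sInf_le ⟨l.map fun i => s (α i), ?_, by simp, rfl⟩
  intro x hx
  obtain ⟨i, hi, rfl⟩ := List.mem_map.mp hx
  exact ⟨i, rfl⟩

lemma lenG_wd (h : AffineSetup α δ θ Bl s) {g : V ≃ₗ[ℝ] V} (hg : g ∈ WoJ α s Set.univ) :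
    ∃ l : List ι, l.length = lenG (Set.range fun i => s (α i)) g ∧ wd α s l = g := by
  have hne : {n | ∃ l : List (V ≃ₗ[ℝ] V), (∀ x ∈ l, x ∈ (Set.range fun i => s (α i))) ∧
      l.length = n ∧ l.prod = g}.Nonempty := by
    obtain ⟨l, -, hl⟩ := exists_wd h hg
    refine ⟨_, l.map fun i => s (α i), ?_, rfl, hl⟩
    intro x hx
    obtain ⟨i, hi, rfl⟩ := List.mem_map.mp hx
    exact ⟨i, rfl⟩
  obtain ⟨l, h1, h2, h3⟩ := Nat.sInf_mem hne
  have : ∃ l' : List ι, l'.map (fun i => s (α i)) = l := by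
    clear h2 h3
    induction l with
    | nil => exact ⟨[], rfl⟩
    | cons x l ih =>
      obtain ⟨l', hl'⟩ := ih fun y hy => h1 y (by simp [hy])
      obtain ⟨i, hi⟩ := h1 x (by simp)
      exact ⟨i :: l', by simp [hl', hi]⟩
  obtain ⟨l', rfl⟩ := this
  refine ⟨l', ?_, h3⟩
  unfold lenG
  rw [← h2]; simp

lemma minrep_pos (h : AffineSetup α δ θ Bl s) {J K : Set ι} {u : V ≃ₗ[ℝ] V}
    (hu : u ∈ MinReps α s J K) : ∀ β ∈ DeloJ α s K, PosoComb α β → PosoComb α (u β) := by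
  have hs : ∀ k ∈ K, PosoComb α (u (α k)) := by
    intro k hk
    have huW := WoJ_sub J hu.1
    rcases pos_or h (act_mem huW (simple_mem (s := s) (α := α) k)) with h1 | h1
    · exact h1
    exfalso
    obtain ⟨l, h2, h3⟩ := lenG_wd h huW
    rw [← h3] at h1
    obtain ⟨l', h4, h5, h6⟩ := exchange h k l h1
    have h7 := hu.2 _ (s_memW hk)
    rw [← h2, ← h3, h6] at h7
    have := lenG_le (α := α) (s := s) l'
    omega
  refine pos_ind h hs ?_
  intro β k hk _ _ _ hp
  rw [map_add]
  obtain ⟨c, hc, e⟩ := hp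
  obtain ⟨c', hc', e'⟩ := hs k hk
  refine ⟨c + c', fun i => add_nonneg (hc i) (hc' i), ?_⟩
  rw [e, e', ← Finset.sum_add_distrib]
  simp [add_smul]

/-- `∘W_K` permutes the positive roots outside `∘Δ_K`. -/
lemma WK_pos (h : AffineSetup α δ θ Bl s) {K : Set ι} {v : V ≃ₗ[ℝ] V} (hv : v ∈ WoJ α s K)
    {β : V} (hβ : β ∈ Delo α s) (hK : β ∉ DeloJ α s K) (hp : PosoComb α β) :
    PosoComb α (v β) := by
  obtain ⟨l, hl, rfl⟩ := exists_wd h hv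
  clear hv
  induction l with
  | nil => exact hp
  | cons i l ih =>
    have hl' : ∀ i ∈ l, i ∈ K := fun i hi => hl i (by simp [hi])
    have hW := wd_mem (α := α) (s := s) hl'
    rw [wd_cons, LinearEquiv.mul_apply]
    refine s_pos h (act_mem (WoJ_sub K hW) hβ) (ih hl') ?_
    intro he
    apply hK
    rw [← act_mem_iff hW, he]
    exact simple_memJ (hl i (by simp))

lemma WK_neg_image (h : AffineSetup α δ θ Bl s) {J K : Set ι} (hKJ : K ⊆ J) {v : V ≃ₗ[ℝ] V}
    (hv : v ∈ WoJ α s K) {β : V} (hβ : β ∈ DeloKJneg α s J K) : v β ∈ DeloKJneg α s J K := by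
  obtain ⟨⟨h1, h2⟩, h3⟩ := hβ
  refine ⟨⟨act_mem (WoJ_mono hKJ hv) h1, fun h4 => h2 ((act_mem_iff hv).mp h4)⟩, ?_⟩
  have := WK_pos h hv (DeloJ_sub J (neg_mem' h h1)) (fun h4 => h2 ((neg_mem_iff' h).mp h4)) h3
  simpa using this

lemma exists_Ku (h : AffineSetup α δ θ Bl s) {J : Set ι} {P : Set V} (hPJ : P ⊆ DeloJ α s J)
    (hneg : ∀ ε ∈ P, -ε ∉ P)
    (hco : ∀ ε ∈ DeloJ α s J, ∀ η ∈ DeloJ α s J, ε ∉ P → η ∉ P → ε + η ∈ DeloJ α s J → ε + η ∉ P) :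
    ∃ K u, K ⊆ J ∧ u ∈ MinReps α s J K ∧ ⇑u '' DeloKJneg α s J K = P := by
  let S : (V ≃ₗ[ℝ] V) → Set V := fun g => {β ∈ DeloJ α s J | PosoComb α β ∧ g β ∈ P}
  have hSfin : ∀ g, (S g).Finite := fun g => (DeloJ_finite h J).subset (Set.sep_subset _ _)
  obtain ⟨u, huJ, humin⟩ : ∃ u ∈ WoJ α s J, ∀ g ∈ WoJ α s J, (S u).ncard ≤ (S g).ncard := by
    obtain ⟨u, hu, hmin⟩ := WellFounded.has_min
      (measure fun g : V ≃ₗ[ℝ] V => (S g).ncard).wf (WoJ α s J : Set (V ≃ₗ[ℝ] V)) ⟨1, one_mem _⟩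
    exact ⟨u, hu, fun g hg => not_lt.mp (hmin g hg)⟩
  have hsimple : ∀ j ∈ J, u (α j) ∉ P := by
    intro j hj hjP
    have h1 := humin (u * s (α j)) (mul_mem huJ (s_memW hj))
    have hsub : (s (α j)) '' (S (u * s (α j))) ⊆ S u \ {α j} := by
      rintro _ ⟨β, ⟨hβ, hp, hβP⟩, rfl⟩
      rw [LinearEquiv.mul_apply] at hβP
      have hne : β ≠ α j := by
        rintro rfl
        rw [s_self h (simple_mem j), map_neg] at hβP
        exact hneg _ hjP hβP
      refine ⟨⟨act_mem (s_memW hj) hβ, s_pos h hβ hp hne, hβP⟩, ?_⟩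
      intro he
      have he' : s (α j) β = α j := he
      have : β = - α j := by
        rw [← s_s h (simple_mem (s := s) j) β, he', s_self h (simple_mem j)]
      rw [this] at hp
      exact not_both h (simple_mem (s := s) j) (simple_pos h j) hp
    have h2 : α j ∈ S u := ⟨simple_memJ hj, simple_pos h j, hjP⟩
    have h3 := Set.ncard_le_ncard hsub ((hSfin u).subset Set.sdiff_subset)
    rw [Set.ncard_image_of_injective _ (s (α j)).injective] at h3
    have h4 := Set.ncard_sdiff_singleton_lt_of_mem h2 (hSfin u)
    omega
  have hposP : ∀ β ∈ DeloJ α s J, PosoComb α β → u β ∉ P := by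
    refine pos_ind h hsimple ?_
    intro β j hj hβ _ hβj hβP
    have := hco _ (act_mem huJ hβ) _ (act_mem huJ (simple_memJ hj)) hβP (hsimple j hj)
    rw [← map_add] at this
    exact this (act_mem huJ hβj)
  let K : Set ι := {j ∈ J | u (-α j) ∉ P}
  have hKJ : K ⊆ J := Set.sep_subset _ _
  have hto : ∀ β ∈ DeloJ α s J, PosoComb α β → u (-β) ∉ P → ∀ i ∉ K, co h β i = 0 := by
    refine pos_ind h ?_ ?_
    · intro j hj hjP i hi
      refine co_ne h ?_
      rintro rfl
      exact hi ⟨hj, hjP⟩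
    · intro β j hj hβ hβp hβj ih hP i hi
      have e1 : u (-α j) ∉ P := by
        have := hco _ (act_mem huJ (neg_mem' h hβj)) _ (act_mem huJ hβ) hP (hposP β hβ hβp)
        rw [← map_add] at this
        have e : -(β + α j) + β = -α j := by abel
        rw [e] at this
        exact this (act_mem huJ (neg_mem' h (simple_memJ hj)))
      have e2 : u (-β) ∉ P := by
        have := hco _ (act_mem huJ (neg_mem' h hβj)) _ (act_mem huJ (simple_memJ hj)) hP
          (hsimple j hj)
        rw [← map_add] at this
        have e : -(β + α j) + α j = -β := by abel
        rw [e] at this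
        exact this (act_mem huJ (neg_mem' h hβ))
      have hij : i ≠ j := by
        rintro rfl
        exact hi ⟨hj, e1⟩
      rw [map_add, Pi.add_apply, ih e2 i hi, co_ne h hij, add_zero]
  have hfrom : ∀ β ∈ DeloJ α s K, PosoComb α β → u (-β) ∉ P := by
    refine pos_ind h (fun j hj => hj.2) ?_
    intro β j hj hβ _ hβj hP
    have := hco _ (act_mem huJ (neg_mem' h (DeloJ_mono hKJ hβ))) _
      (act_mem huJ (neg_mem' h (simple_memJ hj.1))) hP hj.2
    rw [← map_add, ← neg_add] at this
    exact this (act_mem huJ (neg_mem' h (DeloJ_mono hKJ hβj)))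
  have himage : ⇑u '' DeloKJneg α s J K = P := by
    ext x
    constructor
    · rintro ⟨β, ⟨⟨h1, h2⟩, h3⟩, rfl⟩
      by_contra hc
      apply h2
      rw [← neg_mem_iff' h]
      refine supp_mem h _ (DeloJ_sub J (neg_mem' h h1)) h3 ?_
      exact hto _ (neg_mem' h h1) h3 (by simpa using hc)
    · intro hx
      have hx' : u (u⁻¹ x) = x := by simp
      have hβ : u⁻¹ x ∈ DeloJ α s J := act_mem (inv_mem huJ) (hPJ hx)
      have hn : PosoComb α (-(u⁻¹ x)) := by
        rcases pos_or h hβ with h1 | h1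
        · exact absurd (by rw [hx']; exact hx) (hposP _ hβ h1)
        · exact h1
      refine ⟨u⁻¹ x, ⟨⟨hβ, fun hK => ?_⟩, hn⟩, hx'⟩
      refine hfrom _ (neg_mem' h hK) hn ?_
      rw [neg_neg, hx']; exact hx
  obtain ⟨v, hvK, hvmin⟩ : ∃ v ∈ WoJ α s K, ∀ g ∈ WoJ α s K,
      lenG (Set.range fun i => s (α i)) (u * v) ≤ lenG (Set.range fun i => s (α i)) (u * g) := by
    obtain ⟨v, hv, hmin⟩ := WellFounded.has_min
      (measure fun g : V ≃ₗ[ℝ] V => lenG (Set.range fun i => s (α i)) (u * g)).wf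
      (WoJ α s K : Set (V ≃ₗ[ℝ] V)) ⟨1, one_mem _⟩
    exact ⟨v, hv, fun g hg => not_lt.mp (hmin g hg)⟩
  refine ⟨K, u * v, hKJ, ⟨mul_mem huJ (WoJ_mono hKJ hvK), fun w hw => ?_⟩, ?_⟩
  · rw [mul_assoc]; exact hvmin _ (mul_mem hvK hw)
  · rw [← himage]
    ext x
    constructor
    · rintro ⟨β, hβ, rfl⟩
      exact ⟨v β, WK_neg_image h hKJ hvK hβ, rfl⟩
    · rintro ⟨β, hβ, rfl⟩
      refine ⟨v⁻¹ β, WK_neg_image h hKJ (inv_mem hvK) hβ, ?_⟩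
      rw [LinearEquiv.mul_apply]; simp

/-- One half of the uniqueness: positive roots go to positive roots. -/
lemma uniq_aux (h : AffineSetup α δ θ Bl s) {J K K' : Set ι} {u u' : V ≃ₗ[ℝ] V}
    (hKJ' : K' ⊆ J)
    (hu : u ∈ MinReps α s J K) (hu' : u' ∈ MinReps α s J K')
    (he : ⇑u '' DeloKJneg α s J K = ⇑u' '' DeloKJneg α s J K') :
    ∀ β ∈ DeloJ α s J, PosoComb α β → PosoComb α ((u⁻¹ * u') β) := by
  intro β hβ hp
  set γ := (u⁻¹ * u') β with hγ
  have huγ : u γ = u' β := by simp [hγ]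
  have hγJ : γ ∈ DeloJ α s J := act_mem (mul_mem (inv_mem hu.1) hu'.1) hβ
  rcases pos_or h hγJ with h1 | h1
  · exact h1
  exfalso
  by_cases hγK : γ ∈ DeloJ α s K
  · have h2 := minrep_pos h hu _ (neg_mem' h hγK) h1
    rw [map_neg, huγ] at h2
    by_cases hβK : β ∈ DeloJ α s K'
    · exact not_both h (act_mem hu'.1 hβ) (minrep_pos h hu' _ hβK hp) h2
    · have h3 : u' (-β) ∈ ⇑u' '' DeloKJneg α s J K' :=
        ⟨-β, ⟨⟨neg_mem' h hβ, fun h4 => hβK ((neg_mem_iff' h).mp h4)⟩, by simpa using hp⟩, rfl⟩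
      rw [← he] at h3
      obtain ⟨η, hη, hη'⟩ := h3
      rw [map_neg, ← huγ, ← map_neg] at hη'
      have := u.injective hη'
      rw [this] at hη
      exact hη.1.2 (neg_mem' h hγK)
  · have h3 : u γ ∈ ⇑u '' DeloKJneg α s J K := ⟨γ, ⟨⟨hγJ, hγK⟩, h1⟩, rfl⟩
    rw [he] at h3
    obtain ⟨η, hη, hη'⟩ := h3
    rw [huγ] at hη'
    have := u'.injective hη'
    rw [this] at hη
    exact not_both h hβ hp hη.2

lemma uniq (h : AffineSetup α δ θ Bl s) {J K K' : Set ι} {u u' : V ≃ₗ[ℝ] V}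
    (hKJ : K ⊆ J) (hKJ' : K' ⊆ J)
    (hu : u ∈ MinReps α s J K) (hu' : u' ∈ MinReps α s J K')
    (he : ⇑u '' DeloKJneg α s J K = ⇑u' '' DeloKJneg α s J K') : K' = K ∧ u' = u := by
  have h1 : u⁻¹ * u' = 1 := eq_one h (mul_mem (inv_mem hu.1) hu'.1) fun j hj =>
    uniq_aux h hKJ' hu hu' he _ (simple_memJ hj) (simple_pos h j)
  have h2 : u' = u := by
    rw [inv_mul_eq_one] at h1; exact h1.symm
  refine ⟨?_, h2⟩
  subst h2
  have h3 := u'.injective.image_injective he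
  have key : ∀ j ∈ J, ∀ L : Set ι, -α j ∈ DeloKJneg α s J L ↔ j ∉ L := by
    intro j hj L
    constructor
    · intro h4 h5
      exact h4.1.2 (neg_mem' h (simple_memJ h5))
    · intro h4
      refine ⟨⟨neg_mem' h (simple_memJ hj), fun h5 => h4 ?_⟩, by simpa using simple_pos h j⟩
      exact (simple_mem_iff h).mp ((neg_mem_iff' h).mp h5)
  ext j
  constructor
  · intro hj
    by_contra hc
    have := (key j (hKJ' hj) K).mpr hc
    rw [h3] at this
    exact (key j (hKJ' hj) K').mp this hj
  · intro hj
    by_contra hc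
    have := (key j (hKJ hj) K').mpr hc
    rw [← h3] at this
    exact (key j (hKJ hj) K).mp this hj

lemma simple_obtuse (h : AffineSetup α δ θ Bl s) {i j : ι} (hij : i ≠ j) :
    Bl (α i) (α j) ≤ 0 := by
  by_contra hc
  push Not at hc
  have hne : α i ≠ α j := by
    intro he
    have h1 := co_self h i
    rw [he, co_ne h hij] at h1
    norm_num at h1
  have h1 := sub_root h (simple_mem (s := s) (α := α) i) (simple_mem j) hc hne
  rcases pos_or h h1 with h2 | h2
  · have := pos_coef h h2 j
    rw [map_sub, Pi.sub_apply, co_ne h hij.symm, co_self] at this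
    norm_num at this
  · have := pos_coef h h2 i
    rw [map_neg, map_sub, Pi.neg_apply, Pi.sub_apply, co_ne h hij, co_self] at this
    norm_num at this

lemma theta_pos (h : AffineSetup α δ θ Bl s) (i : ι) : 0 < co h θ i := by
  obtain ⟨h1, h2, h3⟩ := h.theta_high
  let A : Set ι := {i | co h θ i = 0}
  have hdom : ∀ j, 0 ≤ Bl θ (α j) := by
    intro j
    by_contra hc
    push Not at hc
    refine h3 j (Set.mem_univ j) (add_root h h1 (simple_mem j) hc ?_)
    intro he
    rw [he] at h2
    exact not_both h (simple_mem (s := s) j) (simple_pos h j) h2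
  have hz : ∀ i ∈ A, ∀ j ∈ Aᶜ, Bl (α j) (α i) = 0 := by
    intro i hi j hj
    have e : Bl θ (α i) = ∑ k, co h θ k * Bl (α k) (α i) := by
      conv_lhs => rw [pos_eq h h2]
      simp
    have hterm : ∀ k ∈ Finset.univ, co h θ k * Bl (α k) (α i) ≤ 0 := by
      intro k _
      by_cases hk : k = i
      · subst hk
        have : co h θ k = 0 := hi
        rw [this]; simp
      · exact mul_nonpos_of_nonneg_of_nonpos (pos_coef h h2 k) (simple_obtuse h hk)
    have hs : ∑ k, co h θ k * Bl (α k) (α i) = 0 :=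
      le_antisymm (Finset.sum_nonpos hterm) (e ▸ hdom i)
    have := (Finset.sum_eq_zero_iff_of_nonpos hterm).mp hs j (Finset.mem_univ j)
    rcases mul_eq_zero.mp this with h4 | h4
    · exact absurd h4 hj
    · exact h4
  rcases h.irred A (fun i hi j hj => by
    rw [refl_root h (simple_mem i), hz i hi j hj]; simp) with hA | hA
  · refine lt_of_le_of_ne (pos_coef h h2 i) fun h4 => ?_
    have : i ∈ A := h4.symm
    rw [hA] at this
    exact this
  · exfalso
    refine root_ne h h1 ?_
    rw [pos_eq h h2]
    refine Finset.sum_eq_zero fun k _ => ?_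
    have : k ∈ A := by rw [hA]; trivial
    have : co h θ k = 0 := this
    rw [this, zero_smul]

lemma delta_pos (h : AffineSetup α δ θ Bl s) : PosComb α δ θ δ := by
  obtain ⟨c, hc, e⟩ := h.theta_high.2.1
  refine ⟨fun o => o.elim 1 c, fun o => by cases o <;> simp [hc], ?_⟩
  rw [Fintype.sum_option]
  simp [alHat, ← e]

lemma PosComb_add {x y : V} (hx : PosComb α δ θ x) (hy : PosComb α δ θ y) :
    PosComb α δ θ (x + y) := by
  obtain ⟨c, hc, rfl⟩ := hx
  obtain ⟨c', hc', rfl⟩ := hy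
  refine ⟨c + c', fun i => add_nonneg (hc i) (hc' i), ?_⟩
  rw [← Finset.sum_add_distrib]
  simp [add_smul]

lemma PosComb_nsmul (h : AffineSetup α δ θ Bl s) (n : ℕ) : PosComb α δ θ (n • δ) := by
  induction n with
  | zero => exact ⟨0, by simp, by simp⟩
  | succ n ih => rw [succ_nsmul]; exact PosComb_add ih (delta_pos h)

/-- membership in a bracket -/
lemma brkt_iff {J : Set ι} {ε : V} (hε : ε ∈ DeloJ α s J) (m : ℕ) :
    (m : ℤ) • δ + ε ∈ brkt α δ θ s ε ↔ PosComb α δ θ ((m : ℤ) • δ + ε) := by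
  have hre : (m : ℤ) • δ + ε ∈ DelRe α δ s := ⟨m, ε, DeloJ_sub J hε, rfl⟩
  constructor
  · intro hh; exact hh.2.2.2
  · intro hh; exact ⟨⟨m, rfl⟩, hre, Or.inl hre, hh⟩

lemma brkt_up (h : AffineSetup α δ θ Bl s) {J : Set ι} {ε : V} (hε : ε ∈ DeloJ α s J) {m n : ℕ}
    (hmn : m ≤ n) (hm : (m : ℤ) • δ + ε ∈ brkt α δ θ s ε) :
    (n : ℤ) • δ + ε ∈ brkt α δ θ s ε := by
  rw [brkt_iff hε] at *
  obtain ⟨k, rfl⟩ := Nat.exists_eq_add_of_le hmn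
  have := PosComb_add hm (PosComb_nsmul h k)
  convert this using 1
  push_cast
  rw [add_smul, natCast_zsmul, natCast_zsmul]; abel

lemma brkt_ev (h : AffineSetup α δ θ Bl s) {J : Set ι} {ε : V} (hε : ε ∈ DeloJ α s J) :
    ∃ N : ℕ, ∀ m ≥ N, (m : ℤ) • δ + ε ∈ brkt α δ θ s ε := by
  have h1 : ∃ N : ℕ, ∀ i, 0 ≤ (N : ℝ) * co h θ i + co h ε i := by
    have : ∀ i, ∃ N : ℕ, - co h ε i / co h θ i ≤ N := fun i => exists_nat_ge _
    choose N hN using this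
    refine ⟨Finset.univ.sup N, fun i => ?_⟩
    have h2 := hN i
    rw [div_le_iff₀ (theta_pos h i)] at h2
    have h3 : N i ≤ Finset.univ.sup N := Finset.le_sup (Finset.mem_univ i)
    have h4 : (N i : ℝ) ≤ (Finset.univ.sup N : ℕ) := by exact_mod_cast h3
    nlinarith [theta_pos h i]
  obtain ⟨N, hN⟩ := h1
  refine ⟨N, fun m hm => brkt_up h hε hm ?_⟩
  rw [brkt_iff hε]
  refine ⟨fun o => o.elim (N : ℝ) fun i => (N : ℝ) * co h θ i + co h ε i,
    fun o => by cases o <;> simp [hN], ?_⟩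
  rw [Fintype.sum_option]
  simp only [alHat, Option.elim]
  simp only [add_smul, mul_smul, Finset.sum_add_distrib, ← Finset.smul_sum]
  rw [← pos_eq h h.theta_high.2.1, ← root_eq h hε, natCast_zsmul, Nat.cast_smul_eq_nsmul, 
    Nat.cast_smul_eq_nsmul, smul_sub]
  abel

lemma dc_val (h : AffineSetup α δ θ Bl s) {J : Set ι} {ε : V} (hε : ε ∈ DeloJ α s J) (m : ℤ) :
    dc h (m • δ + ε) = m := by
  rw [map_add, dc_root h hε, map_zsmul, dc_delta]; simp

lemma lvl_inj (h : AffineSetup α δ θ Bl s) {J : Set ι} {ε η : V} (hε : ε ∈ DeloJ α s J)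
    (hη : η ∈ DeloJ α s J) {m n : ℤ} (he : m • δ + ε = n • δ + η) : m = n ∧ ε = η := by
  have h1 := dc_val h hε m
  rw [he, dc_val h hη] at h1
  have h2 : n = m := by exact_mod_cast h1
  subst h2
  exact ⟨rfl, add_left_cancel he⟩

lemma brkt_disj (h : AffineSetup α δ θ Bl s) {J : Set ι} {ε η x : V} (hε : ε ∈ DeloJ α s J)
    (hη : η ∈ DeloJ α s J) (h1 : x ∈ brkt α δ θ s ε) (h2 : x ∈ brkt α δ θ s η) : ε = η := by
  obtain ⟨⟨m, rfl⟩, -⟩ := h1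
  obtain ⟨⟨n, hn⟩, -⟩ := h2
  exact (lvl_inj h hε hη hn).2

lemma brkt_inf (h : AffineSetup α δ θ Bl s) {J : Set ι} {ε : V} (hε : ε ∈ DeloJ α s J) :
    (brkt α δ θ s ε).Infinite := by
  obtain ⟨N, hN⟩ := brkt_ev h hε
  refine Set.infinite_of_injective_forall_mem (f := fun k : ℕ => ((N + k : ℕ) : ℤ) • δ + ε) ?_
    fun k => hN _ (by omega)
  intro a b hab
  have := (lvl_inj h hε hε hab).1
  omega

lemma im_not_re (h : AffineSetup α δ θ Bl s) {m : ℤ} : m • δ ∉ DelRe α δ s := by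
  rintro ⟨n, ε, hε, he⟩
  have h1 := dc_val h hε n
  rw [← he, map_zsmul, dc_delta] at h1
  have : m = n := by simpa using h1
  subst this
  exact root_ne h hε (by simpa using he)

/-- The set of directions whose whole bracket lies in `B`. -/
def PP (α : ι → V) (δ θ : V) (s : V → V ≃ₗ[ℝ] V) (J : Set ι) (B : Set V) : Set V :=
  {ε ∈ DeloJ α s J | brkt α δ θ s ε ⊆ B}

section
variable {J : Set ι} {B : Set V}

lemma brkt_subA {ε : V} (hε : ε ∈ DeloJ α s J) : brkt α δ θ s ε ⊆ DelJPosB α δ θ s J := by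
  intro x hx
  refine Or.inl ?_
  simp only [brSet, Set.mem_iUnion]
  exact ⟨ε, hε, hx⟩

/-- a missing element of the bracket makes all later ones missing -/
lemma miss_up (h : AffineSetup α δ θ Bl s) (hbi : BiconvexIn (DelJPosB α δ θ s J) B)
    (hreal : B ⊆ DelRePos α δ θ s) {ε : V} (hε : ε ∈ DeloJ α s J) {m n : ℕ} (hmn : m ≤ n)
    (hm : (m : ℤ) • δ + ε ∈ brkt α δ θ s ε) (hmB : (m : ℤ) • δ + ε ∉ B) :
    (n : ℤ) • δ + ε ∉ B := by
  rcases hmn.eq_or_lt with rfl | hlt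
  · exact hmB
  obtain ⟨k, rfl⟩ := Nat.exists_eq_add_of_le hmn
  have hk : 0 < k := by omega
  have e : ((m + k : ℕ) : ℤ) • δ + ε = ((m : ℤ) • δ + ε) + (k : ℤ) • δ := by
    push_cast; rw [add_smul]; abel
  have h1 := brkt_up h hε hmn hm
  have h2 := hbi.2.2 ((m : ℤ) • δ + ε) ⟨brkt_subA hε hm, hmB⟩ ((k : ℤ) • δ)
    ⟨Or.inr ⟨k, hk, rfl⟩, fun hB => im_not_re h (hreal hB).1⟩
  rw [← e] at h2
  exact (h2 (brkt_subA hε h1)).2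

lemma miss_ev (h : AffineSetup α δ θ Bl s) (hbi : BiconvexIn (DelJPosB α δ θ s J) B)
    (hreal : B ⊆ DelRePos α δ θ s) {ε : V} (hε : ε ∈ DeloJ α s J) (hP : ε ∉ PP α δ θ s J B) :
    ∃ N : ℕ, ∀ m ≥ N, (m : ℤ) • δ + ε ∈ brkt α δ θ s ε ∧ (m : ℤ) • δ + ε ∉ B := by
  have : ¬ brkt α δ θ s ε ⊆ B := fun hs => hP ⟨hε, hs⟩
  obtain ⟨x, hx, hxB⟩ := Set.not_subset.mp this
  obtain ⟨⟨m, rfl⟩, -⟩ := id hx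
  exact ⟨m, fun n hn => ⟨brkt_up h hε hn hx, miss_up h hbi hreal hε hn hx hxB⟩⟩

lemma PP_neg (h : AffineSetup α δ θ Bl s) (hbi : BiconvexIn (DelJPosB α δ θ s J) B)
    (hreal : B ⊆ DelRePos α δ θ s) : ∀ ε ∈ PP α δ θ s J B, -ε ∉ PP α δ θ s J B := by
  intro ε hε hn
  obtain ⟨N, hN⟩ := brkt_ev h hε.1
  obtain ⟨M, hM⟩ := brkt_ev h hn.1
  have h1 := hε.2 (hN (N + M + 1) (by omega))
  have h2 := hn.2 (hM (N + M + 1) (by omega))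
  have e : ((N + M + 1 : ℕ) : ℤ) • δ + ε + (((N + M + 1 : ℕ) : ℤ) • δ + -ε)
      = ((2 * (N + M + 1) : ℕ) : ℤ) • δ := by
    push_cast; module
  have h3 := hbi.1.2 _ h1 _ h2
  rw [e] at h3
  exact im_not_re h (hreal (h3 (Or.inr ⟨_, by omega, rfl⟩))).1

lemma PP_co (h : AffineSetup α δ θ Bl s) (hbi : BiconvexIn (DelJPosB α δ θ s J) B)
    (hreal : B ⊆ DelRePos α δ θ s) : ∀ ε ∈ DeloJ α s J, ∀ η ∈ DeloJ α s J,
      ε ∉ PP α δ θ s J B → η ∉ PP α δ θ s J B → ε + η ∈ DeloJ α s J →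
      ε + η ∉ PP α δ θ s J B := by
  intro ε hε η hη h1 h2 h3 h4
  obtain ⟨N, hN⟩ := miss_ev h hbi hreal hε h1
  obtain ⟨M, hM⟩ := miss_ev h hbi hreal hη h2
  obtain ⟨L, hL⟩ := brkt_ev h h3
  obtain ⟨a1, a2⟩ := hN (N + M + L) (by omega)
  obtain ⟨b1, b2⟩ := hM (N + M + L) (by omega)
  have c := hL (2 * (N + M + L)) (by omega)
  have e : ((N + M + L : ℕ) : ℤ) • δ + ε + (((N + M + L : ℕ) : ℤ) • δ + η)
      = ((2 * (N + M + L) : ℕ) : ℤ) • δ + (ε + η) := by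
    push_cast; module
  have h5 := hbi.2.2 _ ⟨brkt_subA hε a1, a2⟩ _ ⟨brkt_subA hη b1, b2⟩
  rw [e] at h5
  exact (h5 (brkt_subA h3 c)).2 (h4.2 c)

lemma PP_fin (h : AffineSetup α δ θ Bl s) (hbi : BiconvexIn (DelJPosB α δ θ s J) B)
    (hreal : B ⊆ DelRePos α δ θ s) : (B \ brSet α δ θ s (PP α δ θ s J B)).Finite := by
  have hsub : B \ brSet α δ θ s (PP α δ θ s J B) ⊆
      ⋃ ε ∈ DeloJ α s J \ PP α δ θ s J B, (B ∩ brkt α δ θ s ε) := by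
    rintro x ⟨hx, hx'⟩
    rcases hbi.1.1 hx with h1 | ⟨m, -, rfl⟩
    · simp only [brSet, Set.mem_iUnion] at h1 hx'
      obtain ⟨ε, hε, h1⟩ := h1
      simp only [Set.mem_iUnion]
      exact ⟨ε, ⟨hε, fun hP => hx' ⟨ε, hP, h1⟩⟩, hx, h1⟩
    · exact absurd (hreal hx).1 (im_not_re h)
  refine Set.Finite.subset (Set.Finite.biUnion ((DeloJ_finite h J).subset Set.sdiff_subset) ?_) hsub
  rintro ε ⟨hε, hP⟩
  obtain ⟨N, hN⟩ := miss_ev h hbi hreal hε hP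
  refine ((Set.finite_lt_nat N).image fun m : ℕ => (m : ℤ) • δ + ε).subset ?_
  rintro x ⟨hx, ⟨m, rfl⟩, -⟩
  refine ⟨m, ?_, rfl⟩
  by_contra hc
  exact (hN m (not_lt.mp hc)).2 hx

end

end Aff

/-- Proposition 6.4: for a real biconvex set `B` in `Δ_{J+}` there exist a unique `K ⊆ J`
and a unique `u ∈ ∘W^K_J` with `Δ^K_J(u, −) ⊆ B` and `B ∖ Δ^K_J(u, −)` finite; moreover,
`B` is infinite iff `K ⊊ J`. -/
theorem statement16 (α : ι → V) (δ θ : V) (Bl : V →ₗ[ℝ] V →ₗ[ℝ] ℝ) (s : V → V ≃ₗ[ℝ] V)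
    (h : AffineSetup α δ θ Bl s) (J : Set ι) (hJ : J.Nonempty) (B : Set V)
    (hbi : BiconvexIn (DelJPosB α δ θ s J) B) (hreal : B ⊆ DelRePos α δ θ s) :
    ∃ (K : Set ι) (u : V ≃ₗ[ℝ] V),
      K ⊆ J ∧ u ∈ MinReps α s J K ∧
      DKJm α δ θ s J K u ⊆ B ∧ (B \ DKJm α δ θ s J K u).Finite ∧
      (B.Infinite ↔ K ⊂ J) ∧
      ∀ (K' : Set ι) (u' : V ≃ₗ[ℝ] V),
        K' ⊆ J → u' ∈ MinReps α s J K' →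
        DKJm α δ θ s J K' u' ⊆ B → (B \ DKJm α δ θ s J K' u').Finite →
        K' = K ∧ u' = u := by
  have hPsub : ∀ ε ∈ Aff.PP α δ θ s J B, ε ∈ DeloJ α s J := fun ε hε => hε.1
  obtain ⟨K, u, hKJ, hu, hP⟩ := Aff.exists_Ku h hPsub (Aff.PP_neg h hbi hreal)
    (Aff.PP_co h hbi hreal)
  have hfin : (B \ brSet α δ θ s (Aff.PP α δ θ s J B)).Finite := Aff.PP_fin h hbi hreal
  have hsub : brSet α δ θ s (Aff.PP α δ θ s J B) ⊆ B := by
    intro x hx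
    simp only [brSet, Set.mem_iUnion] at hx
    obtain ⟨ε, hε, hx⟩ := hx
    exact hε.2 hx
  have hD : DKJm α δ θ s J K u = brSet α δ θ s (Aff.PP α δ θ s J B) := by
    unfold DKJm; rw [hP]
  refine ⟨K, u, hKJ, hu, ?_, ?_, ?_, ?_⟩
  · rw [hD]; exact hsub
  · rw [hD]; exact hfin
  · constructor
    · intro hinf
      refine hKJ.ssubset_of_ne ?_
      rintro rfl
      have hemp : DKJm α δ θ s K K u = ∅ := by
        simp [DKJm, DeloKJneg, brSet]
      rw [← hD, hemp, Set.sdiff_empty] at hfin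
      exact hinf hfin
    · intro hss
      obtain ⟨j, hj, hjK⟩ := Set.exists_of_ssubset hss
      have hm : u (-α j) ∈ Aff.PP α δ θ s J B := by
        rw [← hP]
        refine ⟨_, ⟨⟨Aff.neg_mem' h (Aff.simple_memJ hj), fun h5 => hjK ?_⟩,
          by simpa using Aff.simple_pos h j⟩, rfl⟩
        exact (Aff.simple_mem_iff h).mp ((Aff.neg_mem_iff' h).mp h5)
      exact (Aff.brkt_inf h hm.1).mono hm.2
  · intro K' u' hKJ' hu' hsub' hfin'
    refine Aff.uniq h hKJ hKJ' hu hu' ?_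
    rw [hP]
    have hJ' : ∀ x ∈ ⇑u' '' DeloKJneg α s J K', x ∈ DeloJ α s J := by
      rintro _ ⟨β, hβ, rfl⟩
      exact Aff.act_mem hu'.1 hβ.1.1
    ext ε
    constructor
    · intro hε
      by_contra hc
      refine (Aff.brkt_inf h hε.1) (hfin'.subset fun x hx => ⟨hε.2 hx, fun hx' => ?_⟩)
      simp only [DKJm, brSet, Set.mem_iUnion] at hx'
      obtain ⟨η, hη, hx'⟩ := hx'
      have := Aff.brkt_disj h hε.1 (hJ' η hη) hx hx'
      rw [this] at hc
      exact hc hη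
    · intro hε
      refine ⟨hJ' ε hε, fun x hx => hsub' ?_⟩
      simp only [DKJm, brSet, Set.mem_iUnion]
      exact ⟨ε, hε, hx⟩

end
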